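/- arXiv:cs/0703078 — 3 statements merged into one kernel-verified Lean document; each statement's English description precedes it below -/
import Mathlib

section
/- Blowing-up Lemma (uniform version): let X and Y be nonempty finite sets. For every sequence η : ℕ → ℝ of nonnegative reals with η n → 0 there exist a sequence of natural numbers l : ℕ → ℕ with (l n)/n → 0 and a sequence ε : ℕ → ℝ with ε n → 0 such that for every channel p : X → PMF Y, every n ≥ 1, every input word x : Fin n → X, and every set B ⊆ (Fin n → Y): if the product measure μₓ := ⊗_{i<n} (p (x i)) satisfies μₓ(B) ≥ 2^{−n · η n}, then μₓ(Γ^{l n}(B)) ≥ 1 − ε n, where Γˡ(B) := {y : Fin n → Y | ∃ b ∈ B, hammingDist y b ≤ l} is the Hamming l-neighborhood of B. -/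
open scoped BigOperators ENNReal

open Real in
/-- If `u v ≤ M²` and `u / v ∈ [e^{-2t}, e^{2t}]`, then `u + v ≤ 2 M cosh t`. -/
lemma add_le_two_mul_mul_cosh {u v M t : ℝ} (hM : 0 ≤ M)
    (huv : u * v ≤ M ^ 2) (h₁ : u ≤ exp t ^ 2 * v) (h₂ : v ≤ exp t ^ 2 * u) :
    u + v ≤ 2 * (M * cosh t) := by
  have hE : 0 < exp t := exp_pos t
  have hc : 2 * (M * cosh t) = M * (exp t ^ 2 + 1) / exp t := by
    rw [cosh_eq, exp_neg]
    field_simp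
  rw [hc, le_div_iff₀ hE]
  generalize exp t = E at *
  refine le_of_sq_le_sq ?_ (by positivity)
  have h₃ : 0 ≤ (E ^ 2 * v - u) * (E ^ 2 * u - v) :=
    mul_nonneg (by linarith) (by linarith)
  have h₄ : u * v * (E ^ 2 + 1) ^ 2 ≤ M ^ 2 * (E ^ 2 + 1) ^ 2 := by gcongr
  nlinarith

lemma sum_pi_fin_succ {Y : Type*} [Fintype Y] {n : ℕ} (F : (Fin (n + 1) → Y) → ℝ) :
    ∑ y, F y = ∑ a, ∑ y : Fin n → Y, F (Fin.cons a y) := by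
  rw [← (Fin.consEquiv fun _ : Fin (n + 1) => Y).sum_comp, Fintype.sum_prod_type]
  rfl

lemma hammingDist_fin_cons {Y : Type*} [DecidableEq Y] {n : ℕ} (a b : Y) (y z : Fin n → Y) :
    hammingDist (Fin.cons a y : Fin (n + 1) → Y) (Fin.cons b z) =
      (if a = b then 0 else 1) + hammingDist y z := by
  simp only [hammingDist, Finset.card_filter, Fin.sum_univ_succ, Fin.cons_zero, Fin.cons_succ]
  congr 1
  split_ifs <;> simp_all

open Real in
/-- Two-sided exponential moment bound for functions that are 1-Lipschitz in the Hamming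
distance, under a product probability weight. -/
lemma expMoment_mul_expMoment_neg_le {Y : Type*} [Fintype Y] [DecidableEq Y] (t : ℝ) (ht : 0 ≤ t)
    {n : ℕ} (q : Fin n → Y → ℝ) (hq : ∀ i y, 0 ≤ q i y) (hq1 : ∀ i, ∑ y, q i y = 1)
    (f : (Fin n → Y) → ℝ) (hf : ∀ y z, f y ≤ f z + hammingDist y z) :
    (∑ y, (∏ i, q i (y i)) * exp (t * f y)) * (∑ y, (∏ i, q i (y i)) * exp (-(t * f y))) ≤
      cosh t ^ n := by
  induction n with
  | zero => simp [← exp_add]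
  | succ n ih =>
    set w : (Fin n → Y) → ℝ := fun y => ∏ i : Fin n, q i.succ (y i) with hw
    have hw0 : ∀ y, 0 ≤ w y := fun y => Finset.prod_nonneg fun i _ => hq _ _
    set g : Y → ℝ := fun a => ∑ y, w y * exp (t * f (Fin.cons a y)) with hg
    set h : Y → ℝ := fun a => ∑ y, w y * exp (-(t * f (Fin.cons a y))) with hh
    have hg0 : ∀ a, 0 ≤ g a := fun a =>
      Finset.sum_nonneg fun y _ => mul_nonneg (hw0 y) (exp_pos _).le
    have hh0 : ∀ a, 0 ≤ h a := fun a =>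
      Finset.sum_nonneg fun y _ => mul_nonneg (hw0 y) (exp_pos _).le
    have hfab : ∀ a b y, f (Fin.cons a y) ≤ f (Fin.cons b y) + 1 := by
      intro a b y
      refine (hf _ (Fin.cons b y)).trans ?_
      rw [hammingDist_fin_cons, hammingDist_self]
      split_ifs <;> simp
    have hgab : ∀ a b, g a ≤ exp t * g b := by
      intro a b
      simp only [hg, Finset.mul_sum]
      refine Finset.sum_le_sum fun y _ => ?_
      rw [mul_left_comm, ← exp_add]
      refine mul_le_mul_of_nonneg_left (exp_le_exp.2 ?_) (hw0 y)
      nlinarith [hfab a b y]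
    have hhab : ∀ a b, h a ≤ exp t * h b := by
      intro a b
      simp only [hh, Finset.mul_sum]
      refine Finset.sum_le_sum fun y _ => ?_
      rw [mul_left_comm, ← exp_add]
      refine mul_le_mul_of_nonneg_left (exp_le_exp.2 ?_) (hw0 y)
      nlinarith [hfab b a y]
    have hgh : ∀ a, g a * h a ≤ cosh t ^ n := fun a =>
      ih (fun i => q i.succ) (fun i => hq _) (fun i => hq1 _) (fun y => f (Fin.cons a y))
        fun y z => by
          simpa [hammingDist_fin_cons] using hf (Fin.cons a y) (Fin.cons a z)
    have hM : 0 ≤ cosh t ^ n := pow_nonneg (cosh_pos t).le n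
    have key : ∀ a b, g a * h b + g b * h a ≤ 2 * (cosh t ^ n * cosh t) := by
      intro a b
      refine add_le_two_mul_mul_cosh hM ?_ ?_ ?_
      · calc g a * h b * (g b * h a) = (g a * h a) * (g b * h b) := by ring
          _ ≤ cosh t ^ n * cosh t ^ n :=
            mul_le_mul (hgh a) (hgh b) (mul_nonneg (hg0 _) (hh0 _)) hM
          _ = _ := by ring
      · calc g a * h b ≤ (exp t * g b) * (exp t * h a) :=
            mul_le_mul (hgab a b) (hhab b a) (hh0 _) (mul_nonneg (exp_pos t).le (hg0 _))
          _ = _ := by ring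
      · calc g b * h a ≤ (exp t * g a) * (exp t * h b) :=
            mul_le_mul (hgab b a) (hhab a b) (hh0 _) (mul_nonneg (exp_pos t).le (hg0 _))
          _ = _ := by ring
    have e₁ : ∑ y, (∏ i, q i (y i)) * exp (t * f y) = ∑ a, q 0 a * g a := by
      rw [sum_pi_fin_succ]
      simp only [Fin.prod_univ_succ, Fin.cons_zero, Fin.cons_succ, hg, Finset.mul_sum, hw, mul_assoc]
    have e₂ : ∑ y, (∏ i, q i (y i)) * exp (-(t * f y)) = ∑ a, q 0 a * h a := by
      rw [sum_pi_fin_succ]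
      simp only [Fin.prod_univ_succ, Fin.cons_zero, Fin.cons_succ, hh, Finset.mul_sum, hw, mul_assoc]
    rw [e₁, e₂, pow_succ]
    have s₁ : (∑ a, q 0 a * g a) * (∑ a, q 0 a * h a) =
        ∑ a, ∑ b, q 0 a * q 0 b * (g a * h b) := by
      rw [Finset.sum_mul_sum]
      exact Finset.sum_congr rfl fun a _ => Finset.sum_congr rfl fun b _ => by ring
    have s₂ : (∑ a, q 0 a * g a) * (∑ a, q 0 a * h a) =
        ∑ a, ∑ b, q 0 a * q 0 b * (g b * h a) := by
      rw [mul_comm, Finset.sum_mul_sum]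
      exact Finset.sum_congr rfl fun a _ => Finset.sum_congr rfl fun b _ => by ring
    have s₃ : ∑ a, ∑ b, q 0 a * q 0 b * (g a * h b + g b * h a) ≤
        ∑ a, ∑ b, q 0 a * q 0 b * (2 * (cosh t ^ n * cosh t)) :=
      Finset.sum_le_sum fun a _ => Finset.sum_le_sum fun b _ =>
        mul_le_mul_of_nonneg_left (key a b) (mul_nonneg (hq _ _) (hq _ _))
    have s₄ : ∑ a, ∑ b, q 0 a * q 0 b * (2 * (cosh t ^ n * cosh t)) =
        2 * (cosh t ^ n * cosh t) := by
      simp_rw [← Finset.sum_mul]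
      rw [← Finset.sum_mul_sum, hq1, one_mul, one_mul]
    simp only [mul_add, Finset.sum_add_distrib] at s₃
    linarith

open Real in
/-- Exponential form of the blowing-up property of a product probability weight. -/
lemma sum_hammingDist_gt_mul_sum_le {Y : Type*} [Fintype Y] [DecidableEq Y] (t : ℝ) (ht : 0 ≤ t)
    {n : ℕ} (q : Fin n → Y → ℝ) (hq : ∀ i y, 0 ≤ q i y) (hq1 : ∀ i, ∑ y, q i y = 1)
    (B C : Finset (Fin n → Y)) (l : ℕ) (hC : ∀ y ∈ C, ∀ b ∈ B, l < hammingDist y b) :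
    (∑ y ∈ C, ∏ i, q i (y i)) * (∑ y ∈ B, ∏ i, q i (y i)) ≤ exp (n * t ^ 2 / 2 - t * l) := by
  rcases B.eq_empty_or_nonempty with rfl | hB
  · simpa using (exp_pos _).le
  have hw0 : ∀ y : Fin n → Y, 0 ≤ ∏ i, q i (y i) := fun y => Finset.prod_nonneg fun i _ => hq _ _
  let d : (Fin n → Y) → ℕ := fun y => B.inf' hB (hammingDist y)
  have hd : ∀ y z, (d y : ℝ) ≤ d z + hammingDist y z := by
    intro y z
    obtain ⟨b, hb, hzb⟩ := B.exists_mem_eq_inf' hB (hammingDist z)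
    have h₁ : d y ≤ hammingDist y b := Finset.inf'_le _ hb
    have h₂ : d z = hammingDist z b := hzb
    have h₃ := hammingDist_triangle y z b
    exact_mod_cast (by omega : d y ≤ d z + hammingDist y z)
  have hdB : ∀ y ∈ B, d y = 0 := fun y hy =>
    Nat.le_zero.1 ((Finset.inf'_le _ hy).trans (hammingDist_self y).le)
  have hdC : ∀ y ∈ C, (l : ℝ) ≤ d y := fun y hy =>
    Nat.cast_le.2 (Finset.le_inf' _ _ fun b hb => (hC y hy b hb).le)
  have hmom := expMoment_mul_expMoment_neg_le t ht q hq hq1 (fun y => (d y : ℝ)) hd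
  have hBle : ∑ y ∈ B, ∏ i, q i (y i) ≤ ∑ y, (∏ i, q i (y i)) * exp (-(t * d y)) := by
    refine le_trans (Finset.sum_le_sum fun y hy => ?_) (Finset.sum_le_sum_of_subset_of_nonneg
      (Finset.subset_univ B) fun y _ _ => mul_nonneg (hw0 y) (exp_pos _).le)
    simp [hdB y hy]
  have hCle : exp (t * l) * ∑ y ∈ C, ∏ i, q i (y i) ≤ ∑ y, (∏ i, q i (y i)) * exp (t * d y) := by
    rw [Finset.mul_sum]
    refine le_trans (Finset.sum_le_sum fun y hy => ?_) (Finset.sum_le_sum_of_subset_of_nonneg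
      (Finset.subset_univ C) fun y _ _ => mul_nonneg (hw0 y) (exp_pos _).le)
    rw [mul_comm]
    exact mul_le_mul_of_nonneg_left
      (exp_le_exp.2 (mul_le_mul_of_nonneg_left (hdC y hy) ht)) (hw0 y)
  have hcosh : cosh t ^ n ≤ exp (n * t ^ 2 / 2) := by
    rw [mul_div_assoc, exp_nat_mul]
    exact pow_le_pow_left₀ (cosh_pos t).le (cosh_le_exp_half_sq t) n
  have hprod := mul_le_mul hCle hBle (Finset.sum_nonneg fun y _ => hw0 y)
    (Finset.sum_nonneg fun y _ => mul_nonneg (hw0 y) (exp_pos _).le)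
  rw [exp_sub, le_div_iff₀ (exp_pos _)]
  linarith

/-- **Blowing-up Lemma (uniform version)**: for every vanishing sequence `η` of
nonnegative reals there are a sub-linear sequence of radii `l` and a vanishing
sequence `ε` such that for every channel `p : X → PMF Y`, every `n ≥ 1`, every input
word `x` and every set `B` of output words: if the product measure of `B` is at least
`2^{−n·η n}`, then the Hamming `l n`-neighborhood of `B` has product measure at least
`1 − ε n`. -/
theorem blowing_up_lemma {X Y : Type*} [Fintype X] [Nonempty X]
    [Fintype Y] [Nonempty Y] [DecidableEq Y]
    [MeasurableSpace Y] [MeasurableSingletonClass Y]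
    (η : ℕ → ℝ) (hη0 : ∀ n, 0 ≤ η n)
    (hη : Filter.Tendsto η Filter.atTop (nhds 0)) :
    ∃ (l : ℕ → ℕ) (ε : ℕ → ℝ),
      Filter.Tendsto (fun n : ℕ => (l n : ℝ) / (n : ℝ)) Filter.atTop (nhds 0) ∧
      Filter.Tendsto ε Filter.atTop (nhds 0) ∧
      ∀ (p : X → PMF Y) (n : ℕ), 1 ≤ n → ∀ (x : Fin n → X) (B : Set (Fin n → Y)),
        ENNReal.ofReal ((2 : ℝ) ^ (-(n : ℝ) * η n)) ≤
            MeasureTheory.Measure.pi (fun i => (p (x i)).toMeasure) B →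
        1 - ε n ≤
          (MeasureTheory.Measure.pi (fun i => (p (x i)).toMeasure)
            {y : Fin n → Y | ∃ b ∈ B, hammingDist y b ≤ l n}).toReal := by
  classical
  let δ : ℕ → ℝ := fun n => η n + (√(n : ℝ))⁻¹
  have hδ0 : ∀ n, 0 ≤ δ n := fun n => add_nonneg (hη0 n) (by positivity)
  have hsqrt : Filter.Tendsto (fun n : ℕ => √(n : ℝ)) Filter.atTop Filter.atTop :=
    Real.tendsto_sqrt_atTop.comp tendsto_natCast_atTop_atTop
  have hδ : Filter.Tendsto (fun n => √(δ n)) Filter.atTop (nhds 0) := by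
    simpa using (hη.add hsqrt.inv_tendsto_atTop).sqrt
  refine ⟨fun n => ⌈2 * n * √(δ n)⌉₊, fun n => Real.exp (-√n), ?_, ?_, ?_⟩
  · have hlim : Filter.Tendsto (fun n : ℕ => 2 * √(δ n) + ((n : ℝ))⁻¹) Filter.atTop (nhds 0) := by
      simpa using (hδ.const_mul 2).add (tendsto_inv_atTop_nhds_zero_nat (𝕜 := ℝ))
    refine tendsto_of_tendsto_of_tendsto_of_le_of_le' tendsto_const_nhds hlim
      (Filter.Eventually.of_forall fun n => by positivity) ?_
    filter_upwards [Filter.eventually_gt_atTop 0] with n hn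
    have hn' : (0 : ℝ) < n := Nat.cast_pos.2 hn
    rw [div_le_iff₀ hn', add_mul, inv_mul_cancel₀ hn'.ne']
    have := Nat.ceil_lt_add_one (show 0 ≤ 2 * n * √(δ n) by positivity)
    linarith
  · exact Real.tendsto_exp_neg_atTop_nhds_zero.comp hsqrt
  · intro p n hn x B hB
    have hn' : (0 : ℝ) < n := Nat.cast_pos.2 hn
    set l := ⌈2 * n * √(δ n)⌉₊ with hl
    set μ := MeasureTheory.Measure.pi (fun i => (p (x i)).toMeasure) with hμ
    let q : Fin n → Y → ℝ := fun i y => (p (x i) y).toReal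
    have hq1 : ∀ i, ∑ y, q i y = 1 := fun i => by
      rw [← ENNReal.toReal_sum fun y _ => (p (x i)).apply_ne_top y, ← tsum_fintype (L := .unconditional Y),
        (p (x i)).tsum_coe, ENNReal.toReal_one]
    have hμS : ∀ S : Finset (Fin n → Y), μ.real S = ∑ y ∈ S, ∏ i, q i (y i) := by
      intro S
      rw [← MeasureTheory.sum_measureReal_singleton]
      refine Finset.sum_congr rfl fun y _ => ?_
      simp [MeasureTheory.Measure.real, hμ, q, MeasureTheory.Measure.pi_singleton,
        ENNReal.toReal_prod]
    set G := {y : Fin n → Y | ∃ b ∈ B, hammingDist y b ≤ l} with hG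
    have hBreal : (2 : ℝ) ^ (-(n : ℝ) * η n) ≤ μ.real B :=
      (ENNReal.ofReal_le_iff_le_toReal (MeasureTheory.measure_ne_top _ _)).1 hB
    have hmain := sum_hammingDist_gt_mul_sum_le (l / n : ℝ) (by positivity) q
      (fun _ _ => ENNReal.toReal_nonneg) hq1 B.toFinset Gᶜ.toFinset l (by
        intro y hy b hb
        simp only [Set.mem_toFinset] at hy hb
        by_contra! hle
        exact hy ⟨b, hb, hle⟩)
    rw [← hμS, ← hμS, Set.coe_toFinset, Set.coe_toFinset,
      MeasureTheory.probReal_compl_eq_one_sub G.toFinite.measurableSet] at hmain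
    change 1 - Real.exp (-√n) ≤ μ.real G
    have hle1 : 0 ≤ 1 - μ.real G := sub_nonneg.2 MeasureTheory.measureReal_le_one
    have hpow : (2 : ℝ) ^ (-(n : ℝ) * η n) = Real.exp (-(n * η n * Real.log 2)) := by
      rw [Real.rpow_def_of_pos two_pos]
      congr 1
      ring
    have hlsq : 4 * n * (n * η n + √n) ≤ (l : ℝ) ^ 2 := by
      have hc : 2 * n * √(δ n) ≤ l := Nat.le_ceil _
      have hs : n * (√(n : ℝ))⁻¹ = √n := by
        rw [← div_eq_mul_inv, Real.div_sqrt]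
      calc 4 * n * (n * η n + √n) = (2 * n * √(δ n)) ^ 2 := by
            rw [mul_pow, Real.sq_sqrt (hδ0 n), ← hs]
            ring
        _ ≤ (l : ℝ) ^ 2 := by gcongr
    have hexp : (n * (l / n : ℝ) ^ 2 / 2 - l / n * l) + n * η n * Real.log 2 ≤ -√n := by
      have h₁ : (n * (l / n : ℝ) ^ 2 / 2 - l / n * l) = -((l : ℝ) ^ 2 / (2 * n)) := by
        field_simp
        ring
      have h₂ : 2 * (n * η n + √n) ≤ (l : ℝ) ^ 2 / (2 * n) := by
        rw [le_div_iff₀ (by positivity)]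
        linarith
      have h₃ : n * η n * Real.log 2 ≤ n * η n * 1 :=
        mul_le_mul_of_nonneg_left (Real.log_two_lt_d9.le.trans (by norm_num))
          (mul_nonneg hn'.le (hη0 n))
      have h₄ := mul_nonneg hn'.le (hη0 n)
      have h₅ := Real.sqrt_nonneg (n : ℝ)
      linarith
    rw [hpow] at hBreal
    have hfin := (mul_le_mul_of_nonneg_left hBreal hle1).trans hmain
    rw [Real.exp_neg, ← div_eq_mul_inv, div_le_iff₀ (Real.exp_pos _), ← Real.exp_add] at hfin
    linarith [Real.exp_le_exp.2 hexp]
end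

section
/- Fenchel–Bunt refinement of Carathéodory's theorem: let n ≥ 1 and let S ⊆ ℝⁿ (i.e. Fin n → ℝ) be a set that is the union of at most n preconnected sets, i.e. S = ⋃_{i ∈ Fin n} Sᵢ where each Sᵢ is preconnected. Then every x ∈ convexHull ℝ S can be expressed as a convex combination of n elements of S: there exist weights w : Fin n → ℝ with w i ≥ 0 and ∑ᵢ w i = 1 and points z : Fin n → ℝⁿ with z i ∈ S for all i, such that x = ∑ᵢ w i • z i. -/
open scoped BigOperators

/-- A convex combination supported on a finset with at most `n` elements can be written as a convex
combination indexed by `Fin n`. -/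
theorem exists_fin_convexCombination_of_card_le {E ι : Type*} [AddCommGroup E] [Module ℝ E]
    {S : Set E} {n : ℕ} (t : Finset ι) (ht : t.card ≤ n) (w : ι → ℝ) (z : ι → E)
    (hw : ∀ i ∈ t, 0 ≤ w i) (hw1 : ∑ i ∈ t, w i = 1) (hz : ∀ i ∈ t, z i ∈ S) :
    ∃ (w' : Fin n → ℝ) (z' : Fin n → E), (∀ i, 0 ≤ w' i) ∧ (∑ i, w' i = 1) ∧ (∀ i, z' i ∈ S) ∧
      ∑ i ∈ t, w i • z i = ∑ i, w' i • z' i := by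
  obtain ⟨i₀, hi₀⟩ : t.Nonempty := by
    rw [Finset.nonempty_iff_ne_empty]
    rintro rfl
    simp at hw1
  obtain ⟨e⟩ : Nonempty (t ↪ Fin n) := Function.Embedding.nonempty_of_card_le (by simpa using ht)
  have hext : ∀ j ∉ Set.range e, Function.extend e (fun i : t => w i) 0 j = 0 := fun j hj => by
    rw [Function.extend_apply' _ _ _ (by simpa using hj), Pi.zero_apply]
  refine ⟨Function.extend e (fun i : t => w i) 0,
    Function.extend e (fun i : t => z i) (fun _ => z i₀), fun j => ?_, ?_, fun j => ?_, ?_⟩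
  · by_cases hj : j ∈ Set.range e
    · obtain ⟨i, rfl⟩ := hj
      simpa only [e.injective.extend_apply] using hw i i.2
    · exact (hext j hj).ge
  · rw [← hw1, ← Finset.sum_coe_sort t]
    exact (Fintype.sum_of_injective e e.injective _ _ hext
      fun i => by rw [e.injective.extend_apply]).symm
  · by_cases hj : j ∈ Set.range e
    · obtain ⟨i, rfl⟩ := hj
      simpa only [e.injective.extend_apply] using hz i i.2
    · rw [Function.extend_apply' _ _ _ (by simpa using hj)]
      exact hz i₀ hi₀
  · rw [← Finset.sum_coe_sort t]
    exact Fintype.sum_of_injective e e.injective _ _ (fun j hj => by rw [hext j hj, zero_smul])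
      fun i => by rw [e.injective.extend_apply, e.injective.extend_apply]

/-- If two points of a preconnected set have distinct strict maximizers among finitely many
continuous functions, then at some point of the set the maximum is attained at least twice. -/
theorem IsPreconnected.exists_maximum_attained_twice {X ι : Type*} [TopologicalSpace X] [Finite ι]
    {T : Set X} (hT : IsPreconnected T) {f : ι → X → ℝ} (hf : ∀ i, Continuous (f i)) {a b : X}
    (ha : a ∈ T) (hb : b ∈ T) {i j : ι} (hij : i ≠ j) (hi : ∀ k ≠ i, f k a < f i a)
    (hj : ∀ k ≠ j, f k b < f j b) :
    ∃ y ∈ T, ∃ p q, p ≠ q ∧ f p y = f q y ∧ ∀ k, f k y ≤ f p y := by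
  by_contra! hcon
  let U : ι → Set X := fun p => {y | ∀ k ≠ p, f k y < f p y}
  have hU : ∀ p, IsOpen (U p) := fun p => by
    simp only [U, Set.ofPred_forall]
    exact isOpen_iInter_of_finite fun k => isOpen_iInter_of_finite fun _ =>
      isOpen_lt (hf k) (hf p)
  have hcover : T ⊆ U i ∪ ⋃ p ≠ i, U p := fun y hy => by
    have : Nonempty ι := ⟨i⟩
    obtain ⟨p, hp⟩ := Finite.exists_max fun k => f k y
    have hpU : y ∈ U p := fun k hk => (hp k).lt_of_ne fun h => by
      obtain ⟨l, hl⟩ := hcon y hy p k hk.symm h.symm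
      exact (hp l).not_gt hl
    by_cases hpi : p = i
    · exact Or.inl (hpi ▸ hpU)
    · exact Or.inr (Set.mem_biUnion hpi hpU)
  obtain ⟨y, -, hyi, hy⟩ := hT (U i) (⋃ p ≠ i, U p) (hU i)
    (isOpen_biUnion fun p _ => hU p) hcover ⟨a, ha, hi⟩ ⟨b, hb, Set.mem_biUnion hij.symm hj⟩
  obtain ⟨p, hp, hyp⟩ := Set.mem_iUnion₂.1 hy
  exact (hyi p hp).asymm (hyp i (Ne.symm hp))

/-- Exchange step: if the largest ratio `c k / w k` is attained at two distinct indices, then in the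
convex combination `∑ k, w k • z k` the two corresponding points can be replaced by the single point
`∑ k, c k • z k`. -/
theorem exists_convexCombination_exchange {E ι : Type*} [AddCommGroup E] [Module ℝ E] [Fintype ι]
    [DecidableEq ι] (z : ι → E) {w c : ι → ℝ} (hw : ∀ i, 0 < w i) (hw1 : ∑ i, w i = 1)
    (hc1 : ∑ i, c i = 1) {p q : ι} (hpq : p ≠ q) (heq : c p / w p = c q / w q)
    (hmax : ∀ k, c k / w k ≤ c p / w p) :
    ∃ v : ι → ℝ, (∀ i, 0 ≤ v i) ∧ ∑ i ∈ Finset.univ.erase p, v i = 1 ∧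
      ∑ i ∈ Finset.univ.erase p, v i • Function.update z q (∑ k, c k • z k) i =
        ∑ i, w i • z i := by
  have hcp : 0 < c p := by
    obtain ⟨k, -, hk⟩ : ∃ k ∈ Finset.univ, 0 < c k :=
      Finset.exists_lt_of_sum_lt (by simp [hc1])
    exact (div_pos_iff_of_pos_right (hw p)).1 ((div_pos hk (hw k)).trans_le (hmax k))
  set t : ℝ := w p / c p with ht
  have ht0 : 0 < t := div_pos (hw p) hcp
  have htc : ∀ k, t * c k ≤ w k := fun k => by
    have h := hmax k
    rw [div_le_div_iff₀ (hw k) (hw p)] at h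
    rw [ht, div_mul_eq_mul_div, div_le_iff₀ hcp]
    linarith
  have htp : w p - t * c p = 0 := by rw [ht]; field_simp; ring
  have htq : w q - t * c q = 0 := by
    rw [div_eq_div_iff (hw p).ne' (hw q).ne'] at heq
    rw [ht]
    field_simp
    linarith
  have hupd : (fun i => Function.update (fun k => w k - t * c k) q t i •
      Function.update z q (∑ k, c k • z k) i) =
      Function.update (fun k => (w k - t * c k) • z k) q (t • ∑ k, c k • z k) := by
    ext i
    by_cases h : i = q
    · subst h; simp
    · simp [h]
  refine ⟨Function.update (fun k => w k - t * c k) q t, fun k => ?_, ?_, ?_⟩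
  · by_cases h : k = q
    · subst h; simpa using ht0.le
    · simpa [h] using htc k
  · rw [Finset.sum_erase _ (by simp [hpq, htp]), Finset.sum_update_of_mem (Finset.mem_univ q),
      ← Finset.erase_eq, Finset.sum_erase (f := fun k => w k - t * c k) _ htq,
      Finset.sum_sub_distrib, ← Finset.mul_sum, hw1, hc1]
    ring
  · rw [Finset.sum_erase _ (by simp [hpq, htp]), hupd,
      Finset.sum_update_of_mem (Finset.mem_univ q), ← Finset.erase_eq,
      Finset.sum_erase _ (by simp [htq])]
    simp only [sub_smul, Finset.sum_sub_distrib, mul_smul, ← Finset.smul_sum]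
    abel

/-- **Fenchel–Bunt refinement of Carathéodory's theorem**: if `S ⊆ ℝⁿ` (with `n ≥ 1`)
is a union of at most `n` preconnected sets, then every point of `convexHull ℝ S` is a
convex combination of `n` elements of `S`. -/
theorem fenchel_bunt (n : ℕ) (hn : 1 ≤ n) (S : Set (Fin n → ℝ))
    (Sᵢ : Fin n → Set (Fin n → ℝ)) (hconn : ∀ i, IsPreconnected (Sᵢ i))
    (hS : S = ⋃ i, Sᵢ i)
    (x : Fin n → ℝ) (hx : x ∈ convexHull ℝ S) :
    ∃ (w : Fin n → ℝ) (z : Fin n → Fin n → ℝ),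
      (∀ i, 0 ≤ w i) ∧ (∑ i, w i = 1) ∧ (∀ i, z i ∈ S) ∧ x = ∑ i, w i • z i := by
  classical
  obtain ⟨ι, hι, z, w, hzS, hind, hw, hw1, rfl⟩ := eq_pos_convex_span_of_mem_convexHull hx
  have hz : ∀ i, z i ∈ S := fun i => hzS ⟨i, rfl⟩
  by_cases hcard : Fintype.card ι ≤ n
  · exact exists_fin_convexCombination_of_card_le Finset.univ hcard w z (fun i _ => (hw i).le) hw1
      fun i _ => hz i
  have hle : Fintype.card ι ≤ n + 1 := by
    simpa using hind.card_le_finrank_succ.trans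
      (Nat.add_le_add_right (Submodule.finrank_le _) 1)
  have hcard' : Fintype.card ι = n + 1 := by omega
  let B : AffineBasis ι ℝ (Fin n → ℝ) :=
    ⟨z, hind, hind.affineSpan_eq_top_iff_card_eq_finrank_add_one.2 (by simpa using hcard')⟩
  have hmem : ∀ i, ∃ k, z i ∈ Sᵢ k := fun i => Set.mem_iUnion.1 (hS ▸ hz i)
  choose g hg using hmem
  obtain ⟨i, j, hij, hgij⟩ := Fintype.exists_ne_map_eq_of_card_lt g (by simp [hcard'])
  have hstrict : ∀ i, ∀ k ≠ i, B.coord k (z i) / w k < B.coord i (z i) / w i := fun i k hk => by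
    rw [show z i = B i from rfl, B.coord_apply_ne hk, B.coord_apply_eq, zero_div]
    exact one_div_pos.2 (hw i)
  obtain ⟨y, hy, p, q, hpq, heq, hmax⟩ :=
    (hconn (g i)).exists_maximum_attained_twice (f := fun k y => B.coord k y / w k)
      (fun k => (continuous_barycentric_coord B k).div_const _) (hg i) (hgij ▸ hg j) hij
      (hstrict i) (hstrict j)
  obtain ⟨v, hv, hv1, hvz⟩ := exists_convexCombination_exchange z hw hw1
    (B.sum_coord_apply_eq_one y) hpq heq hmax
  rw [← hvz, show ∑ k, B.coord k y • z k = y from B.linear_combination_coord_eq_self y]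
  refine exists_fin_convexCombination_of_card_le _ (by simp [hcard']) v _ (fun i _ => hv i) hv1
    fun k _ => ?_
  by_cases h : k = q
  · subst h
    simpa [hS] using ⟨g i, hy⟩
  · simpa [h] using hz k
end

section
/- Core inequality of the weak converse: let (Ω, μ) be a probability space, let M₁, M₂ ≥ 1, and let W₁ : Ω → Fin M₁ and W₂ : Ω → Fin M₂ be independent random variables with W₂ uniformly distributed on Fin M₂. Let B be a finite set, Y : Ω → B a measurable random variable, and g : B × Fin M₁ → Option (Fin M₂) a decoder with λ ≥ μ{ω : g(Y ω, W₁ ω) ≠ some (W₂ ω)}. Then, with mutual information and logarithms in nats, log M₂ ≤ I[(W₁, W₂) : Y] + λ · log M₂ + log 2. -/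
open scoped BigOperators

noncomputable section

/-- Shannon entropy (in nats) of a finitely-valued random variable `X` on `(Ω, μ)`. -/
def rvEntropy {Ω S : Type*} [MeasurableSpace Ω] (μ : MeasureTheory.Measure Ω)
    [Fintype S] (X : Ω → S) : ℝ :=
  ∑ s : S, Real.negMulLog (μ (X ⁻¹' {s})).toReal

/-- Conditional Shannon entropy (in nats) `H[X | Z] = H[(X,Z)] - H[Z]`. -/
def rvCondEntropy {Ω S T : Type*} [MeasurableSpace Ω] (μ : MeasureTheory.Measure Ω)
    [Fintype S] [Fintype T] (X : Ω → S) (Z : Ω → T) : ℝ :=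
  rvEntropy μ (fun ω => (X ω, Z ω)) - rvEntropy μ Z

/-- Mutual information (in nats) `I[X : Y] = H[X] + H[Y] - H[(X,Y)]`. -/
def rvMutualInfo {Ω S T : Type*} [MeasurableSpace Ω] (μ : MeasureTheory.Measure Ω)
    [Fintype S] [Fintype T] (X : Ω → S) (Y : Ω → T) : ℝ :=
  rvEntropy μ X + rvEntropy μ Y - rvEntropy μ (fun ω => (X ω, Y ω))

open MeasureTheory

/-- The joint law of two finitely-valued random variables has the right first marginal. -/
lemma sum_measureReal_preimage_prodMk {Ω S T : Type*} [MeasurableSpace Ω] (μ : Measure Ω)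
    [IsFiniteMeasure μ] [Fintype T] (X : Ω → S) (Y : Ω → T)
    (hY : ∀ t, MeasurableSet (Y ⁻¹' {t})) (s : S) :
    ∑ t, μ.real ((fun ω => (X ω, Y ω)) ⁻¹' {(s, t)}) = μ.real (X ⁻¹' {s}) := by
  have h := sum_measureReal_preimage_singleton (μ := μ.restrict (X ⁻¹' {s}))
    (Finset.univ : Finset T) (f := Y) (fun t _ => hY t)
  simp only [Finset.coe_univ, Set.preimage_univ, measureReal_restrict_apply_univ] at h
  rw [← h]
  refine Finset.sum_congr rfl fun t _ => ?_
  rw [measureReal_restrict_apply (hY t)]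
  congr 1
  ext ω
  simp [and_comm]

lemma measureReal_preimage_prodMk_comm {Ω S T : Type*} [MeasurableSpace Ω] (μ : Measure Ω)
    (X : Ω → S) (Y : Ω → T) (s : S) (t : T) :
    μ.real ((fun ω => (X ω, Y ω)) ⁻¹' {(s, t)}) =
      μ.real ((fun ω => (Y ω, X ω)) ⁻¹' {(t, s)}) := by
  congr 1
  ext ω
  simp [and_comm]

lemma mul_log_add_sub_le_mul_log {p q : ℝ} (hp : 0 < p) (hq : 0 < q) :
    p * Real.log q + p - q ≤ p * Real.log p := by
  have h := Real.log_le_sub_one_of_pos (div_pos hq hp)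
  rw [Real.log_div hq.ne' hp.ne'] at h
  have h2 := mul_le_mul_of_nonneg_left h hp.le
  have h3 : p * (q / p - 1) = q - p := by field_simp
  linarith

/-- Variational lower bound on mutual information: a positive function `d` whose integral against
the product of the marginals is at most `1` satisfies `E[log d(X, Y)] ≤ I[X : Y]`. -/
lemma sum_mul_log_le_rvMutualInfo {Ω S T : Type*} [MeasurableSpace Ω] (μ : Measure Ω)
    [IsProbabilityMeasure μ] [Fintype S] [Fintype T] (X : Ω → S) (Y : Ω → T)
    (hX : ∀ s, MeasurableSet (X ⁻¹' {s})) (hY : ∀ t, MeasurableSet (Y ⁻¹' {t}))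
    (d : S × T → ℝ) (hd : ∀ z, 0 < d z)
    (hsum : ∑ z : S × T, μ.real (X ⁻¹' {z.1}) * μ.real (Y ⁻¹' {z.2}) * d z ≤ 1) :
    ∑ z, μ.real ((fun ω => (X ω, Y ω)) ⁻¹' {z}) * Real.log (d z) ≤ rvMutualInfo μ X Y := by
  set P : S × T → ℝ := fun z => μ.real ((fun ω => (X ω, Y ω)) ⁻¹' {z}) with hP
  set a : S → ℝ := fun s => μ.real (X ⁻¹' {s}) with ha
  set b : T → ℝ := fun t => μ.real (Y ⁻¹' {t}) with hb
  have hPa (s : S) : ∑ t, P (s, t) = a s := sum_measureReal_preimage_prodMk μ X Y hY s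
  have hPb (t : T) : ∑ s, P (s, t) = b t := by
    simp only [hP, measureReal_preimage_prodMk_comm μ X Y]
    exact sum_measureReal_preimage_prodMk μ Y X hX t
  have hP0 (z : S × T) : 0 ≤ P z := measureReal_nonneg
  have ha0 (s : S) : 0 ≤ a s := measureReal_nonneg
  have hb0 (t : T) : 0 ≤ b t := measureReal_nonneg
  have hPa_le (z : S × T) : P z ≤ a z.1 := by
    rw [← hPa]
    exact Finset.single_le_sum (f := fun t => P (z.1, t)) (fun t _ => hP0 _) (Finset.mem_univ z.2)
  have hPb_le (z : S × T) : P z ≤ b z.2 := by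
    rw [← hPb]
    exact Finset.single_le_sum (f := fun s => P (s, z.2)) (fun s _ => hP0 _) (Finset.mem_univ z.1)
  have hPsum : ∑ z, P z = 1 := by
    rw [Fintype.sum_prod_type]
    simp only [hPa]
    have h := sum_measureReal_preimage_singleton (μ := μ)
      (Finset.univ : Finset S) (f := X) (fun s _ => hX s)
    simpa using h
  have hpoint (z : S × T) :
      P z * Real.log (a z.1) + P z * Real.log (b z.2) + P z * Real.log (d z) + P z
        - a z.1 * b z.2 * d z ≤ P z * Real.log (P z) := by
    have hq : 0 ≤ a z.1 * b z.2 * d z := mul_nonneg (mul_nonneg (ha0 _) (hb0 _)) (hd z).le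
    rcases (hP0 z).eq_or_lt with h0 | h0
    · rw [← h0]; simpa using hq
    · have h1 := h0.trans_le (hPa_le z)
      have h2 := h0.trans_le (hPb_le z)
      have h := mul_log_add_sub_le_mul_log h0 (mul_pos (mul_pos h1 h2) (hd z))
      rw [Real.log_mul (mul_pos h1 h2).ne' (hd z).ne', Real.log_mul h1.ne' h2.ne'] at h
      linarith
  have hgibbs := Finset.sum_le_sum fun z (_ : z ∈ (Finset.univ : Finset (S × T))) => hpoint z
  simp only [Finset.sum_add_distrib, Finset.sum_sub_distrib] at hgibbs
  have hA : ∑ z : S × T, P z * Real.log (a z.1) = -rvEntropy μ X := by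
    rw [Fintype.sum_prod_type]
    simp only [← Finset.sum_mul, hPa, rvEntropy, Real.negMulLog, neg_mul, Finset.sum_neg_distrib,
      neg_neg]
    rfl
  have hB : ∑ z : S × T, P z * Real.log (b z.2) = -rvEntropy μ Y := by
    rw [Fintype.sum_prod_type_right]
    simp only [← Finset.sum_mul, hPb, rvEntropy, Real.negMulLog, neg_mul, Finset.sum_neg_distrib,
      neg_neg]
    rfl
  have hAB : ∑ z : S × T, P z * Real.log (P z) = -rvEntropy μ (fun ω => (X ω, Y ω)) := by
    simp only [rvEntropy, Real.negMulLog, neg_mul, Finset.sum_neg_distrib, neg_neg]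
    rfl
  unfold rvMutualInfo
  linarith

/-- **Core inequality of the weak converse**: if `W₁` and `W₂` are independent, `W₂`
is uniformly distributed on `Fin M₂`, and the decoder `g` recovers `W₂` from `(Y, W₁)`
with error probability at most `lam`, then
`log M₂ ≤ I[(W₁, W₂) : Y] + lam · log M₂ + log 2` (in nats). -/
theorem weak_converse_core {Ω : Type*} [MeasurableSpace Ω]
    (μ : MeasureTheory.Measure Ω) [MeasureTheory.IsProbabilityMeasure μ]
    (M₁ M₂ : ℕ) (hM₁ : 1 ≤ M₁) (hM₂ : 1 ≤ M₂)
    (W₁ : Ω → Fin M₁) (W₂ : Ω → Fin M₂)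
    {B : Type*} [Fintype B] [Nonempty B] (Y : Ω → B)
    (hW₁ : ∀ w, MeasurableSet (W₁ ⁻¹' {w}))
    (hW₂ : ∀ w, MeasurableSet (W₂ ⁻¹' {w}))
    (hY : ∀ b, MeasurableSet (Y ⁻¹' {b}))
    (hindep : ∀ (w₁ : Fin M₁) (w₂ : Fin M₂),
      μ (W₁ ⁻¹' {w₁} ∩ W₂ ⁻¹' {w₂}) = μ (W₁ ⁻¹' {w₁}) * μ (W₂ ⁻¹' {w₂}))
    (hunif : ∀ w₂ : Fin M₂, μ (W₂ ⁻¹' {w₂}) = 1 / (M₂ : ENNReal))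
    (g : B × Fin M₁ → Option (Fin M₂)) (lam : ℝ)
    (hlam : (μ {ω | g (Y ω, W₁ ω) ≠ some (W₂ ω)}).toReal ≤ lam) :
    Real.log M₂ ≤ rvMutualInfo μ (fun ω => (W₁ ω, W₂ ω)) Y
      + lam * Real.log M₂ + Real.log 2 := by
  classical
  have hM : (0 : ℝ) < M₂ := by exact_mod_cast hM₂
  set W : Ω → Fin M₁ × Fin M₂ := fun ω => (W₁ ω, W₂ ω) with hWdef
  have hWpre (w : Fin M₁ × Fin M₂) : W ⁻¹' {w} = W₁ ⁻¹' {w.1} ∩ W₂ ⁻¹' {w.2} := by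
    ext ω
    simp [hWdef, Prod.ext_iff]
  have hW (w : Fin M₁ × Fin M₂) : MeasurableSet (W ⁻¹' {w}) := by
    rw [hWpre]
    exact (hW₁ _).inter (hW₂ _)
  have hWreal (w : Fin M₁ × Fin M₂) : μ.real (W ⁻¹' {w}) = μ.real (W₁ ⁻¹' {w.1}) * (1 / M₂) := by
    rw [hWpre, measureReal_def, hindep, hunif]
    simp [measureReal_def]
  let correct : (Fin M₁ × Fin M₂) × B → Prop := fun z => g (z.2, z.1.1) = some z.1.2
  let d : (Fin M₁ × Fin M₂) × B → ℝ := fun z => (if correct z then (M₂ : ℝ) else 0) / 2 + 1 / 2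
  have hd (z) : 0 < d z := by
    dsimp only [d]
    split_ifs <;> positivity
  have hcount (w₁ : Fin M₁) (b : B) : ∑ w₂, 1 / (M₂ : ℝ) * d ((w₁, w₂), b) ≤ 1 := by
    have h : ∑ w₂, (if correct ((w₁, w₂), b) then (M₂ : ℝ) else 0) ≤ M₂ := by
      rcases hg : g (b, w₁) with _ | v <;> simp [correct, hg]
    rw [← Finset.mul_sum, Finset.sum_add_distrib, ← Finset.sum_div]
    simp only [Finset.sum_const, Finset.card_univ, Fintype.card_fin, nsmul_eq_mul]
    rw [one_div_mul_eq_div, div_le_one hM]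
    linarith
  have hone₁ : ∑ w₁, μ.real (W₁ ⁻¹' {w₁}) = 1 := by
    simpa using sum_measureReal_preimage_singleton (μ := μ)
      Finset.univ (f := W₁) (fun w _ => hW₁ w)
  have honeY : ∑ b, μ.real (Y ⁻¹' {b}) = 1 := by
    simpa using sum_measureReal_preimage_singleton (μ := μ)
      Finset.univ (f := Y) (fun b _ => hY b)
  have hsum : ∑ z : (Fin M₁ × Fin M₂) × B,
      μ.real (W ⁻¹' {z.1}) * μ.real (Y ⁻¹' {z.2}) * d z ≤ 1 := by
    calc _ = ∑ b, ∑ w₁, μ.real (Y ⁻¹' {b}) * μ.real (W₁ ⁻¹' {w₁}) *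
          ∑ w₂, 1 / (M₂ : ℝ) * d ((w₁, w₂), b) := by
          rw [Fintype.sum_prod_type_right]
          refine Finset.sum_congr rfl fun b _ => ?_
          rw [Fintype.sum_prod_type]
          refine Finset.sum_congr rfl fun w₁ _ => ?_
          rw [Finset.mul_sum]
          refine Finset.sum_congr rfl fun w₂ _ => ?_
          rw [hWreal]
          ring
      _ ≤ ∑ b, ∑ w₁, μ.real (Y ⁻¹' {b}) * μ.real (W₁ ⁻¹' {w₁}) := by
          refine Finset.sum_le_sum fun b _ => Finset.sum_le_sum fun w₁ _ => ?_
          exact mul_le_of_le_one_right (by positivity) (hcount w₁ b)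
      _ = 1 := by simp only [← Finset.mul_sum, hone₁, mul_one, honeY]
  have hI := sum_mul_log_le_rvMutualInfo μ W Y hW hY d hd hsum
  have hWY (z : (Fin M₁ × Fin M₂) × B) : MeasurableSet ((fun ω => (W ω, Y ω)) ⁻¹' {z}) := by
    have : (fun ω => (W ω, Y ω)) ⁻¹' {z} = W ⁻¹' {z.1} ∩ Y ⁻¹' {z.2} := by
      ext ω
      simp [Prod.ext_iff]
    rw [this]
    exact (hW _).inter (hY _)
  have htotal : ∑ z, μ.real ((fun ω => (W ω, Y ω)) ⁻¹' {z}) = 1 := by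
    simpa using sum_measureReal_preimage_singleton (μ := μ)
      Finset.univ (f := fun ω => (W ω, Y ω)) (fun z _ => hWY z)
  have herr : ∑ z, μ.real ((fun ω => (W ω, Y ω)) ⁻¹' {z}) * (if correct z then 0 else 1) ≤ lam := by
    have h := sum_measureReal_preimage_singleton (μ := μ)
      (Finset.univ.filter fun z => ¬ correct z) (f := fun ω => (W ω, Y ω)) (fun z _ => hWY z)
    rw [Finset.sum_filter] at h
    simp only [mul_ite, mul_zero, mul_one]
    simp only [ite_not] at h
    rw [h]
    refine le_of_eq_of_le ?_ hlam
    rw [measureReal_def]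
    congr 2
    ext ω
    simp [correct, hWdef]
  have hlog (z) : Real.log M₂ - (if correct z then 0 else 1) * Real.log M₂ - Real.log 2
      ≤ Real.log (d z) := by
    by_cases hz : correct z
    · have h : Real.log ((M₂ : ℝ) / 2) ≤ Real.log (d z) :=
        Real.log_le_log (by positivity) (by simp [d, hz])
      rw [Real.log_div hM.ne' two_ne_zero] at h
      simpa [hz] using h
    · simp [d, hz]
  have hbound := Finset.sum_le_sum fun z (_ : z ∈ (Finset.univ : Finset _)) =>
    mul_le_mul_of_nonneg_left (hlog z)
      (measureReal_nonneg (μ := μ) (s := (fun ω => (W ω, Y ω)) ⁻¹' {z}))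
  simp only [mul_sub, Finset.sum_sub_distrib, ← mul_assoc, ← Finset.sum_mul, htotal,
    one_mul] at hbound
  have hlogM : 0 ≤ Real.log (M₂ : ℝ) := Real.log_nonneg (by exact_mod_cast hM₂)
  have := mul_le_mul_of_nonneg_right herr hlogM
  linarith
end
end
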